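/- arXiv:2506.01309 — 2 statements merged into one kernel-verified Lean document; each statement's English description precedes it below -/
import Mathlib

section
/- Let α̃₁, α̃₂, α̃₃ ∈ (0, 2π) \ {π}. There exist γ₂, γ₃ ∈ [−π, π] satisfying the three-fold compatibility condition R₂(γ₂) R₃(γ₃) t̃₄ = t̃₁ if and only if |−cos α̃₃ + cos α̃₁ cos α̃₂| ≤ |sin α̃₁ sin α̃₂| and |−cos α̃₁ + cos α̃₂ cos α̃₃| ≤ |sin α̃₂ sin α̃₃| (i.e. the sector angles lie in the admissible domain). -/
open Real

noncomputable section

/-- `ℝ³` as triples of reals. -/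
abbrev V3 : Type := Fin 3 → ℝ

/-- Euclidean dot product on `ℝ³`. -/
def dot3 (u v : V3) : ℝ := u 0 * v 0 + u 1 * v 1 + u 2 * v 2

/-- Cross product on `ℝ³`. -/
def cross3 (u v : V3) : V3 :=
  ![u 1 * v 2 - u 2 * v 1, u 2 * v 0 - u 0 * v 2, u 0 * v 1 - u 1 * v 0]

/-- Rotation of `ℝ³` about the unit axis `a` by angle `γ` (Rodrigues' formula,
right-hand rule). -/
def rot (a : V3) (γ : ℝ) (v : V3) : V3 :=
  Real.cos γ • v + Real.sin γ • cross3 a v + ((1 - Real.cos γ) * dot3 a v) • a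

/-- `R_{e₃}(φ) e₁ = (cos φ, sin φ, 0)`, the crease tangents of the intermediate state. -/
def tvec (φ : ℝ) : V3 := ![Real.cos φ, Real.sin φ, 0]

/-- The vector with coordinates `x`, `y`, `z` in the orthonormal frame obtained by rotating the
standard basis about `e₃` by the angle `φ`. -/
def inFrame (φ x y z : ℝ) : V3 :=
  ![Real.cos φ * x - Real.sin φ * y, Real.sin φ * x + Real.cos φ * y, z]

lemma rot_inFrame (φ γ x y z : ℝ) :
    rot (tvec φ) γ (inFrame φ x y z) =
      inFrame φ x (y * Real.cos γ - z * Real.sin γ) (z * Real.cos γ + y * Real.sin γ) := by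
  have h := Real.sin_sq_add_cos_sq φ
  funext i
  fin_cases i
  · simp [rot, tvec, inFrame, cross3, dot3]
    linear_combination (1 - Real.cos γ) * x * Real.cos φ * h
  · simp [rot, tvec, inFrame, cross3, dot3]
    linear_combination (1 - Real.cos γ) * x * Real.sin φ * h
  · simp [rot, tvec, inFrame, cross3, dot3]
    linear_combination Real.sin γ * y * h

lemma inFrame_inj {φ x y z x' y' z' : ℝ} :
    inFrame φ x y z = inFrame φ x' y' z' ↔ x = x' ∧ y = y' ∧ z = z' := by
  refine ⟨fun h => ?_, by rintro ⟨rfl, rfl, rfl⟩; rfl⟩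
  have h0 := congrFun h 0
  have h1 := congrFun h 1
  have h2 := congrFun h 2
  simp only [inFrame, Matrix.cons_val] at h0 h1 h2
  have hφ := Real.sin_sq_add_cos_sq φ
  refine ⟨?_, ?_, h2⟩
  · linear_combination Real.cos φ * h0 + Real.sin φ * h1 - (x - x') * hφ
  · linear_combination Real.cos φ * h1 - Real.sin φ * h0 - (y - y') * hφ

lemma inFrame_add (φ β x y z : ℝ) :
    inFrame (φ + β) x y z =
      inFrame φ (Real.cos β * x - Real.sin β * y) (Real.sin β * x + Real.cos β * y) z := by
  funext i
  fin_cases i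
  · simp [inFrame, Real.cos_add, Real.sin_add]
    ring
  · simp [inFrame, Real.cos_add, Real.sin_add]
    ring
  · simp [inFrame]

lemma tvec_add (φ β : ℝ) : tvec (φ + β) = inFrame φ (Real.cos β) (Real.sin β) 0 := by
  simp [tvec, inFrame, Real.cos_add, Real.sin_add]

lemma compatibility_iff (a b c γ₂ γ₃ : ℝ) :
    rot (tvec a) γ₂ (rot (tvec (a + b)) γ₃ (tvec (a + b + c))) = tvec 0 ↔
      Real.cos b * Real.cos c - Real.sin b * (Real.sin c * Real.cos γ₃) = Real.cos a ∧
      Real.sin b * Real.cos c + Real.cos b * (Real.sin c * Real.cos γ₃) =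
        -(Real.sin a * Real.cos γ₂) ∧
      Real.sin c * Real.sin γ₃ = Real.sin a * Real.sin γ₂ := by
  have h0 : tvec 0 = inFrame a (Real.cos a) (-Real.sin a) 0 := by
    simpa using tvec_add a (-a)
  rw [tvec_add (a + b) c, rot_inFrame, inFrame_add, rot_inFrame, h0, inFrame_inj]
  simp only [zero_mul, sub_zero, zero_add]
  have hγ := Real.sin_sq_add_cos_sq γ₂
  refine and_congr_right fun _ => ⟨fun ⟨hy, hz⟩ => ⟨?_, ?_⟩, fun ⟨hy, hz⟩ => ⟨?_, ?_⟩⟩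
  · linear_combination Real.cos γ₂ * hy + Real.sin γ₂ * hz -
      (Real.sin b * Real.cos c + Real.cos b * (Real.sin c * Real.cos γ₃)) * hγ
  · linear_combination Real.cos γ₂ * hz - Real.sin γ₂ * hy -
      Real.sin c * Real.sin γ₃ * hγ
  · linear_combination Real.cos γ₂ * hy - Real.sin γ₂ * hz - Real.sin a * hγ
  · linear_combination Real.cos γ₂ * hz + Real.sin γ₂ * hy

lemma exists_cos_eq_of_abs_le {u v : ℝ} (hv : v ≠ 0) (h : |u| ≤ |v|) :
    ∃ γ ∈ Set.Icc (-π) π, v * Real.cos γ = u := by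
  have hle : |u / v| ≤ 1 := by
    rw [abs_div]
    exact div_le_one_of_le₀ h (abs_nonneg v)
  refine ⟨Real.arccos (u / v), ⟨?_, Real.arccos_le_pi _⟩, ?_⟩
  · linarith [Real.arccos_nonneg (u / v), Real.pi_pos]
  · rw [Real.cos_arccos (abs_le.mp hle).1 (abs_le.mp hle).2]
    field_simp

lemma abs_mul_cos_le (v γ : ℝ) : |v * Real.cos γ| ≤ |v| := by
  rw [abs_mul]
  exact mul_le_of_le_one_right (abs_nonneg v) (Real.abs_cos_le_one γ)

lemma sin_ne_zero_of_mem_Ioo {α : ℝ} (h : α ∈ Set.Ioo 0 (2 * π)) (h' : α ≠ π) :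
    Real.sin α ≠ 0 := by
  rcases lt_or_gt_of_ne h' with hlt | hgt
  · exact (Real.sin_pos_of_pos_of_lt_pi h.1 hlt).ne'
  · have := Real.sin_pos_of_pos_of_lt_pi (x := α - π) (by linarith) (by linarith [h.2])
    rw [Real.sin_sub_pi] at this
    exact (neg_pos.mp this).ne

/-- For sector angles `α̃₁, α̃₂, α̃₃ ∈ (0,2π)\{π}`, there exist folding angles
`γ₂, γ₃ ∈ [−π,π]` satisfying the three-fold compatibility condition iff the sector angles lie
in the admissible domain. -/
theorem threefold_admissible_domain (α₁ α₂ α₃ : ℝ)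
    (h₁ : α₁ ∈ Set.Ioo 0 (2 * π)) (h₁' : α₁ ≠ π)
    (h₂ : α₂ ∈ Set.Ioo 0 (2 * π)) (h₂' : α₂ ≠ π)
    (h₃ : α₃ ∈ Set.Ioo 0 (2 * π)) (h₃' : α₃ ≠ π) :
    (∃ γ₂ ∈ Set.Icc (-π) π, ∃ γ₃ ∈ Set.Icc (-π) π,
        rot (tvec α₁) γ₂ (rot (tvec (α₁ + α₂)) γ₃ (tvec (α₁ + α₂ + α₃))) = tvec 0) ↔
      |-Real.cos α₃ + Real.cos α₁ * Real.cos α₂| ≤ |Real.sin α₁ * Real.sin α₂| ∧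
        |-Real.cos α₁ + Real.cos α₂ * Real.cos α₃| ≤ |Real.sin α₂ * Real.sin α₃| := by
  have hs₁ := sin_ne_zero_of_mem_Ioo h₁ h₁'
  have hs₂ := sin_ne_zero_of_mem_Ioo h₂ h₂'
  have hs₃ := sin_ne_zero_of_mem_Ioo h₃ h₃'
  have ha := Real.sin_sq_add_cos_sq α₁
  have hb := Real.sin_sq_add_cos_sq α₂
  have hc := Real.sin_sq_add_cos_sq α₃
  simp only [compatibility_iff]
  constructor
  · rintro ⟨γ₂, -, γ₃, -, hx, hy, -⟩
    constructor
    · convert abs_mul_cos_le (Real.sin α₁ * Real.sin α₂) γ₂ using 2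
      linear_combination -Real.cos α₂ * hx - Real.sin α₂ * hy + Real.cos α₃ * hb
    · convert abs_mul_cos_le (Real.sin α₂ * Real.sin α₃) γ₃ using 2
      linear_combination hx
  · rintro ⟨hle₂, hle₃⟩
    obtain ⟨γ₂, hγ₂, hcos₂⟩ := exists_cos_eq_of_abs_le (mul_ne_zero hs₁ hs₂) hle₂
    obtain ⟨γ₃, hγ₃, hcos₃⟩ := exists_cos_eq_of_abs_le (mul_ne_zero hs₂ hs₃) hle₃
    have hx : Real.cos α₂ * Real.cos α₃ - Real.sin α₂ * (Real.sin α₃ * Real.cos γ₃) =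
        Real.cos α₁ := by
      linear_combination -hcos₃
    have hy : Real.sin α₂ * Real.cos α₃ + Real.cos α₂ * (Real.sin α₃ * Real.cos γ₃) =
        -(Real.sin α₁ * Real.cos γ₂) := by
      apply mul_left_cancel₀ hs₂
      linear_combination Real.cos α₂ * hcos₃ + hcos₂ + Real.cos α₃ * hb
    have hsq : (Real.sin α₃ * Real.sin γ₃) ^ 2 = (Real.sin α₁ * Real.sin γ₂) ^ 2 := by
      have hγ₂' := Real.sin_sq_add_cos_sq γ₂
      have hγ₃' := Real.sin_sq_add_cos_sq γ₃
      have hx2 := congrArg (· ^ 2) hx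
      have hy2 := congrArg (· ^ 2) hy
      linear_combination Real.sin α₃ ^ 2 * hγ₃' - Real.sin α₁ ^ 2 * hγ₂' + hc - ha - hx2 - hy2 +
        (Real.cos α₃ ^ 2 + (Real.sin α₃ * Real.cos γ₃) ^ 2) * hb
    rcases sq_eq_sq_iff_eq_or_eq_neg.mp hsq with hz | hz
    · exact ⟨γ₂, hγ₂, γ₃, hγ₃, hx, hy, hz⟩
    · refine ⟨-γ₂, ⟨neg_le_neg hγ₂.2, neg_le.mp hγ₂.1⟩, γ₃, hγ₃, hx, ?_, ?_⟩
      · rw [Real.cos_neg, hy]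
      · rw [Real.sin_neg, hz, mul_neg]
end
end

section
/- Let α̃₁, α̃₂, α̃₃, α̃₄ ∈ (0, π) and suppose γ₂, γ₃, γ₄ ∈ [−π, π] satisfy the four-fold compatibility condition R₂(γ₂) R₃(γ₃) R₄(γ₄) t̃₅ = t̃₁. Then cos γ₄ = (cos α̃₃ cos α̃₄ − cos α̃₁ cos α̃₂ + sin α̃₁ sin α̃₂ cos γ₂)/(sin α̃₃ sin α̃₄). -/
open Real

noncomputable section

theorem dot3_tvec_self (φ : ℝ) : dot3 (tvec φ) (tvec φ) = 1 := by
  simp [dot3, tvec, ← sq]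

theorem dot3_rot_self {a : V3} (ha : dot3 a a = 1) (γ : ℝ) (v : V3) :
    dot3 a (rot a γ v) = dot3 a v := by
  simp only [dot3] at ha
  simp [dot3, rot, cross3, Matrix.vecHead, Matrix.vecTail]
  linear_combination
    ((1 - Real.cos γ) * (a 0 * v 0 + a 1 * v 1 + a 2 * v 2)) * ha

theorem cross3_rot (a : V3) (γ : ℝ) (v : V3) :
    cross3 a (rot a γ v) =
      Real.cos γ • cross3 a v + Real.sin γ • (dot3 a v • a - dot3 a a • v) := by
  ext i
  fin_cases i <;> simp [dot3, rot, cross3, Matrix.vecHead, Matrix.vecTail] <;> ring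

theorem rot_neg_rot {a : V3} (ha : dot3 a a = 1) (γ : ℝ) (v : V3) :
    rot a (-γ) (rot a γ v) = v := by
  rw [rot, dot3_rot_self ha, cross3_rot, ha, rot]
  ext i
  simp only [Real.cos_neg, Real.sin_neg, Pi.add_apply, Pi.sub_apply, Pi.smul_apply, smul_eq_mul]
  linear_combination (v i - dot3 a v * a i) * Real.sin_sq_add_cos_sq γ

/-- The spherical law of cosines. -/
theorem dot3_tvec_rot_tvec (φ γ α β : ℝ) :
    dot3 (tvec (φ + α)) (rot (tvec φ) γ (tvec (φ + β))) =
      Real.cos α * Real.cos β + Real.sin α * Real.sin β * Real.cos γ := by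
  have hsum (x y : ℝ) : dot3 (tvec x) (tvec y) = Real.cos (x - y) := by
    simp [dot3, tvec, Real.cos_sub]
  have hrot : dot3 (tvec (φ + α)) (rot (tvec φ) γ (tvec (φ + β))) =
      Real.cos γ * dot3 (tvec (φ + α)) (tvec (φ + β)) +
        (1 - Real.cos γ) * dot3 (tvec φ) (tvec (φ + β)) * dot3 (tvec (φ + α)) (tvec φ) := by
    simp [dot3, rot, cross3, tvec]
    ring
  rw [hrot, hsum, hsum, hsum, add_sub_add_left_eq_sub, sub_add_cancel_left, add_sub_cancel_left,
    Real.cos_neg, Real.cos_sub]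
  ring

/-- If `γ₂, γ₃, γ₄ ∈ [−π,π]` satisfy the four-fold compatibility condition
`R₂(γ₂)R₃(γ₃)R₄(γ₄)t̃₅ = t̃₁`, then
`cos γ₄ = (cos α̃₃ cos α̃₄ − cos α̃₁ cos α̃₂ + sin α̃₁ sin α̃₂ cos γ₂)/(sin α̃₃ sin α̃₄)`. -/
theorem fourfold_cos_gamma₄ (α₁ α₂ α₃ α₄ : ℝ)
    (h₁ : α₁ ∈ Set.Ioo 0 π) (h₂ : α₂ ∈ Set.Ioo 0 π)
    (h₃ : α₃ ∈ Set.Ioo 0 π) (h₄ : α₄ ∈ Set.Ioo 0 π)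
    (γ₂ γ₃ γ₄ : ℝ) (hγ₂ : γ₂ ∈ Set.Icc (-π) π) (hγ₃ : γ₃ ∈ Set.Icc (-π) π)
    (hγ₄ : γ₄ ∈ Set.Icc (-π) π)
    (hcompat : rot (tvec α₁) γ₂ (rot (tvec (α₁ + α₂)) γ₃
        (rot (tvec (α₁ + α₂ + α₃)) γ₄ (tvec (α₁ + α₂ + α₃ + α₄)))) = tvec 0) :
    Real.cos γ₄ = (Real.cos α₃ * Real.cos α₄ - Real.cos α₁ * Real.cos α₂ +
        Real.sin α₁ * Real.sin α₂ * Real.cos γ₂) / (Real.sin α₃ * Real.sin α₄) := by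
  have h := congrArg (fun v => dot3 (tvec (α₁ + α₂)) (rot (tvec α₁) (-γ₂) v)) hcompat
  have hl := dot3_tvec_rot_tvec (α₁ + α₂ + α₃) γ₄ (-α₃) α₄
  have hr := dot3_tvec_rot_tvec α₁ (-γ₂) α₂ (-α₁)
  simp only [rot_neg_rot (dot3_tvec_self _), dot3_rot_self (dot3_tvec_self _)] at h
  rw [add_neg_cancel_right, Real.cos_neg, Real.sin_neg] at hl
  rw [add_neg_cancel, Real.cos_neg, Real.sin_neg, Real.cos_neg] at hr
  have hs₃ := (Real.sin_pos_of_mem_Ioo h₃).ne'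
  have hs₄ := (Real.sin_pos_of_mem_Ioo h₄).ne'
  rw [eq_div_iff (mul_ne_zero hs₃ hs₄)]
  linear_combination hl - hr - h
end
end
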